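/- Every floor-randomized, left-continuous mechanism satisfying strict downward distortion (q(θ) < q_e(θ) for all θ > θ̲ and q(θ̲) = q_e(θ̲)) is undominated. -/

import Mathlib

open Set Filter MeasureTheory

noncomputable def V (P : ℝ → ℝ) (q : ℝ) : ℝ := ∫ z in (0:ℝ)..q, P z

/-- Incentive compatibility: `q·r` decreasing plus the envelope formula. -/
def IC (θl θh : ℝ) (r q u : ℝ → ℝ) : Prop :=
  AntitoneOn (fun θ => q θ * r θ) (Set.Icc θl θh) ∧
  ∀ θ ∈ Set.Icc θl θh, u θ = u θh + ∫ z in θ..θh, q z * r z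

/-- Individual rationality. -/
def IR (θh : ℝ) (u : ℝ → ℝ) : Prop := 0 ≤ u θh

/-- Feasibility of the operation and quantity rules. -/
def Valid (θl θh qbar : ℝ) (r q : ℝ → ℝ) : Prop :=
  (∀ θ ∈ Set.Icc θl θh, r θ ∈ Set.Icc (0:ℝ) 1) ∧
  ∀ θ ∈ Set.Icc θl θh, q θ ∈ Set.Icc (0:ℝ) qbar

/-- Regulator's surplus at type θ with welfare weight α. -/
noncomputable def RS (P : ℝ → ℝ) (c α : ℝ) (r q u : ℝ → ℝ) (θ : ℝ) : ℝ :=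
  r θ * (V P (q θ) - c - θ * q θ) - (1 - α) * u θ

/-- Floor-randomized mechanism with quantity floor `qhat`. -/
def FloorRandomized (θl θh qhat : ℝ) (r q u : ℝ → ℝ) : Prop :=
  IC θl θh r q u ∧ IR θh u ∧ u θh = 0 ∧
  ∃ T1 T01 T0 : Set ℝ,
    T1 ∪ T01 ∪ T0 = Set.Icc θl θh ∧
    (∀ x ∈ T01, ∀ y ∈ T1, y < x) ∧
    (∀ x ∈ T0, ∀ y ∈ T01, y < x) ∧
    (∀ x ∈ T0, ∀ y ∈ T1, y < x) ∧
    T1.OrdConnected ∧ T01.OrdConnected ∧ T0.OrdConnected ∧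
    (∀ θ ∈ T1, qhat ≤ q θ ∧ r θ = 1) ∧
    (∀ θ ∈ T01, q θ = qhat ∧ r θ ∈ Set.Ioo (0:ℝ) 1) ∧
    (∀ θ ∈ T0, q θ = 0 ∧ r θ = 0)

/-- Quantity rule of the floor-randomized transformation of an effective quantity `qt`. -/
noncomputable def qT (qhat : ℝ) (qt : ℝ → ℝ) (θ : ℝ) : ℝ :=
  if 0 < qt θ then max (qt θ) qhat else 0

/-- Operation rule of the floor-randomized transformation. -/
noncomputable def rT (qhat : ℝ) (qt : ℝ → ℝ) (θ : ℝ) : ℝ :=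
  if 0 < qt θ then min (qt θ / qhat) 1 else 0

/-- Rent of the floor-randomized transformation. -/
noncomputable def uT (θh : ℝ) (qt : ℝ → ℝ) (θ : ℝ) : ℝ := ∫ z in θ..θh, qt z

/-- Mechanism `(r', q', u')` dominates `(r, q, u)`. -/
def Dominates (θl θh : ℝ) (P : ℝ → ℝ) (c α : ℝ) (r' q' u' r q u : ℝ → ℝ) : Prop :=
  (∀ θ ∈ Set.Icc θl θh, RS P c α r q u θ ≤ RS P c α r' q' u' θ) ∧
  ∃ θ ∈ Set.Icc θl θh, RS P c α r q u θ < RS P c α r' q' u' θ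

/-- Undominated IC and IR mechanism. -/
def Undominated (θl θh qbar : ℝ) (P : ℝ → ℝ) (c α : ℝ) (r q u : ℝ → ℝ) : Prop :=
  Valid θl θh qbar r q ∧ IC θl θh r q u ∧ IR θh u ∧
  ¬ ∃ r' q' u', Valid θl θh qbar r' q' ∧ IC θl θh r' q' u' ∧ IR θh u' ∧
      Dominates θl θh P c α r' q' u' r q u

/-- Left-continuity of the effective quantity `q·r`. -/
def LeftCont (θl θh : ℝ) (r q : ℝ → ℝ) : Prop :=
  ∀ θ ∈ Set.Ioc θl θh,
    Filter.Tendsto (fun z => q z * r z) (nhdsWithin θ (Set.Iio θ)) (nhds (q θ * r θ))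

/-- Downward distortion with respect to the efficient quantity rule `qe`. -/
def DD (θl θh : ℝ) (qe q : ℝ → ℝ) : Prop :=
  (∀ θ ∈ Set.Icc θl θh, q θ ≤ qe θ) ∧ q θl = qe θl

theorem aux_tangent (qbar : ℝ) (P : ℝ → ℝ)
    (hPcont : ContinuousOn P (Icc 0 qbar))
    (hPanti : StrictAntiOn P (Icc 0 qbar)) (a s : ℝ) (ha : a ∈ Icc 0 qbar) (hs : s ∈ Icc 0 qbar) :
    V P a ≤ V P s + P s * (a - s) := by
  have hint : ∀ x ∈ Icc 0 qbar, ∀ y ∈ Icc 0 qbar, IntervalIntegrable P volume x y := by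
    intro x hx y hy
    apply ContinuousOn.intervalIntegrable
    exact hPcont.mono (ordConnected_Icc.uIcc_subset hx hy)
  have h00 : (0:ℝ) ∈ Icc 0 qbar := ⟨le_refl _, ha.1.trans ha.2⟩
  have hadd : V P s + ∫ z in s..a, P z = V P a :=
    intervalIntegral.integral_add_adjacent_intervals (hint _ h00 _ hs) (hint _ hs _ ha)
  rcases le_total s a with h | h
  · have : ∫ z in s..a, P z ≤ ∫ z in s..a, P s := by
      apply intervalIntegral.integral_mono_on h (hint _ hs _ ha) (by simp)
      intro z hz
      exact hPanti.antitoneOn hs ⟨hs.1.trans hz.1, hz.2.trans ha.2⟩ hz.1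
    simp only [intervalIntegral.integral_const, smul_eq_mul] at this
    linarith
  · have : ∫ z in a..s, P s ≤ ∫ z in a..s, P z := by
      apply intervalIntegral.integral_mono_on h (by simp) (hint _ ha _ hs)
      intro z hz
      exact hPanti.antitoneOn ⟨ha.1.trans hz.1, hz.2.trans hs.2⟩ hs hz.2
    simp only [intervalIntegral.integral_const, smul_eq_mul] at this
    rw [intervalIntegral.integral_symm] at hadd
    linarith

theorem aux_abs (a b k : ℝ) (x y g D : ℝ → ℝ) (hab : a < b) (hk : 0 < k)
    (hx : AntitoneOn x (Icc a b)) (hy : AntitoneOn y (Icc a b))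
    (hD : ∀ t ∈ Icc a b, D t = D b + ∫ z in t..b, (y z - x z))
    (hDb : 0 ≤ D b) (hga : g a = 0) (hg : ∀ t ∈ Ioc a b, 0 < g t)
    (hgl : ∀ t ∈ Ioc a b, ∃ δ > 0, ∃ l < t, ∀ z ∈ Ioc l t, δ ≤ g z)
    (hxl : ∀ t ∈ Ioc a b, Tendsto x (nhdsWithin t (Iio t)) (nhds (x t)))
    (hdom : ∀ t ∈ Icc a b, k * D t ≤ g t * (y t - x t)) :
    (∀ t ∈ Icc a b, D t = 0) ∧ ∀ t ∈ Ioc a b, y t = x t := by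
  have hint : ∀ s ∈ Icc a b, ∀ t ∈ Icc a b, IntervalIntegrable (fun z => y z - x z) volume s t := by
    intro s hs t ht
    have hsub := ordConnected_Icc.uIcc_subset hs ht
    exact (hy.mono hsub).intervalIntegrable.sub (hx.mono hsub).intervalIntegrable
  have hbm : b ∈ Icc a b := right_mem_Icc.2 hab.le
  have hDD : ∀ s ∈ Icc a b, ∀ t ∈ Icc a b, D s = D t + ∫ z in s..t, (y z - x z) := by
    intro s hs t ht
    rw [hD s hs, hD t ht, ← intervalIntegral.integral_add_adjacent_intervals (hint s hs t ht)
      (hint t ht b hbm)]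
    ring
  have hcont : ContinuousOn D (Icc a b) := by
    have h1 : ContinuousOn (fun t => D b + ∫ z in t..b, (y z - x z)) (Icc a b) := by
      apply continuousOn_const.add
      have h2 := intervalIntegral.continuousOn_primitive_interval_left
        (f := fun z => y z - x z) (μ := volume) (a := a) (b := b) (by
          have := hint a (left_mem_Icc.2 hab.le) b hbm
          rw [uIcc_of_le hab.le]
          exact (intervalIntegrable_iff_integrableOn_Icc_of_le hab.le).1 this)
      rwa [uIcc_of_le hab.le] at h2
    exact h1.congr hD
  have hDa : D a ≤ 0 := by
    have := hdom a (left_mem_Icc.2 hab.le)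
    rw [hga] at this
    nlinarith
  -- Step 1
  have hyx : ∀ t ∈ Ioc a b, 0 ≤ D t → x t ≤ y t := by
    intro t ht h
    have h1 := hdom t ⟨ht.1.le, ht.2⟩
    have h2 := hg t ht
    by_contra! h3
    nlinarith [mul_nonneg hk.le h]
  have hDle : ∀ t ∈ Icc a b, D t ≤ 0 := by
    intro t ht
    by_contra! hpos
    have hsub : Icc a t ⊆ Icc a b := Icc_subset_Icc_right ht.2
    have hcomp : IsCompact (Icc a t ∩ D ⁻¹' (Iic 0)) :=
      isCompact_Icc.of_isClosed_subset
        ((hcont.mono hsub).preimage_isClosed_of_isClosed isClosed_Icc isClosed_Iic)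
        inter_subset_left
    obtain ⟨s, hs, hsmax⟩ := hcomp.exists_isGreatest ⟨a, left_mem_Icc.2 ht.1, hDa⟩
    have hs0 : D s ≤ 0 := hs.2
    have h1 := hDD s (hsub hs.1) t ht
    have h2 : 0 ≤ ∫ z in s..t, (y z - x z) := by
      have := intervalIntegral.integral_mono_on_of_le_Ioo (f := fun _ => (0:ℝ))
        (g := fun z => y z - x z) (μ := volume) hs.1.2 (by simp) (hint s (hsub hs.1) t ht) (by
          intro z hz
          have hza : a < z := hs.1.1.trans_lt hz.1
          have : 0 < D z := by
            by_contra! h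
            exact absurd (hsmax ⟨⟨hza.le, hz.2.le⟩, h⟩) (not_le.2 hz.1)
          have := hyx z ⟨hza, hz.2.le.trans ht.2⟩ this.le
          linarith)
      simpa using this
    linarith
  have hDb0 : D b = 0 := le_antisymm (hDle b hbm) hDb
  -- Step 2
  have hD0 : ∀ t ∈ Ioc a b, D t = 0 := by
    intro t1 ht1
    by_contra hne
    have hneg : D t1 < 0 := lt_of_le_of_ne (hDle t1 ⟨ht1.1.le, ht1.2⟩) hne
    have hsub : Icc t1 b ⊆ Icc a b := Icc_subset_Icc_left ht1.1.le
    have hcomp : IsCompact (Icc t1 b ∩ D ⁻¹' {0}) :=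
      isCompact_Icc.of_isClosed_subset
        ((hcont.mono hsub).preimage_isClosed_of_isClosed isClosed_Icc isClosed_singleton)
        inter_subset_left
    obtain ⟨t, ht, htmin⟩ := hcomp.exists_isLeast ⟨b, right_mem_Icc.2 ht1.2, hDb0⟩
    have ht0 : D t = 0 := ht.2
    have htlt : t1 < t := lt_of_le_of_ne ht.1.1 (by rintro rfl; exact hne ht0)
    have htm : t ∈ Ioc a b := ⟨ht1.1.trans htlt, ht.1.2⟩
    obtain ⟨δ, hδ, l, hl, hgl'⟩ := hgl t htm
    obtain ⟨l', hl'1, hl't⟩ : ∃ l', max (max t1 l) (t - δ / k) < l' ∧ l' < t := by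
      apply exists_between
      have : 0 < δ / k := by positivity
      simp [htlt, hl, this]
    simp only [max_lt_iff] at hl'1
    obtain ⟨⟨hA, hB⟩, hC⟩ := hl'1
    have hsub2 : Icc l' t ⊆ Icc a b := Icc_subset_Icc (ht1.1.trans hA).le htm.2
    obtain ⟨w, hw, hwmin⟩ := isCompact_Icc.exists_isMinOn (nonempty_Icc.2 hl't.le)
      (hcont.mono hsub2)
    have hneg' : ∀ z ∈ Icc l' t, z < t → D z < 0 := by
      intro z hz hzt
      refine lt_of_le_of_ne (hDle z (hsub2 hz)) fun h => ?_
      exact absurd (htmin ⟨⟨hA.le.trans hz.1, hz.2.trans htm.2⟩, h⟩) (not_le.2 hzt)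
    have hDw : D w < 0 := by
      have h1 := hneg' l' (left_mem_Icc.2 hl't.le) hl't
      have h2 : D w ≤ D l' := hwmin (left_mem_Icc.2 hl't.le)
      linarith
    have hwt : w < t := lt_of_le_of_ne hw.2 (by rintro rfl; linarith)
    have h1 := hDD w (hsub2 hw) t (hsub2 (right_mem_Icc.2 hl't.le))
    have h2 : ∫ z in w..t, (k / δ * D w) ≤ ∫ z in w..t, (y z - x z) := by
      apply intervalIntegral.integral_mono_on hwt.le (by simp)
        (hint w (hsub2 hw) t (hsub2 (right_mem_Icc.2 hl't.le)))
      intro z hz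
      have hz' : z ∈ Icc l' t := ⟨hw.1.trans hz.1, hz.2⟩
      have e1 : D w ≤ D z := hwmin hz'
      have e2 := hdom z (hsub2 hz')
      have e3 := hgl' z ⟨hB.trans_le hz'.1, hz.2⟩
      have hkd : 0 < k / δ := by positivity
      rcases le_total 0 (y z - x z) with h | h
      · nlinarith
      · have e4 : g z * (y z - x z) ≤ δ * (y z - x z) := by nlinarith
        have e5 : k * D w ≤ δ * (y z - x z) := by nlinarith
        rw [div_mul_eq_mul_div, div_le_iff₀ hδ]
        linarith
    simp only [intervalIntegral.integral_const, smul_eq_mul] at h2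
    have h3 : (t - w) * (k / δ) < 1 := by
      have : t - w < δ / k := by linarith [hw.1]
      calc (t - w) * (k / δ) < δ / k * (k / δ) := by gcongr
        _ = 1 := by field_simp
    nlinarith
  have hDa0 : D a = 0 := by
    refine le_antisymm hDa ?_
    rw [hDD a (left_mem_Icc.2 hab.le) b hbm, hDb0, zero_add]
    have := intervalIntegral.integral_mono_on_of_le_Ioo (f := fun _ => (0:ℝ))
        (g := fun z => y z - x z) (μ := volume) hab.le (by simp)
        (hint a (left_mem_Icc.2 hab.le) b hbm) (by
          intro z hz
          have := hyx z ⟨hz.1, hz.2.le⟩ (hD0 z ⟨hz.1, hz.2.le⟩).ge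
          linarith)
    simpa using this
  have hDz : ∀ t ∈ Icc a b, D t = 0 := by
    intro t ht
    rcases eq_or_lt_of_le ht.1 with h | h
    · rw [← h]; exact hDa0
    · exact hD0 t ⟨h, ht.2⟩
  refine ⟨hDz, fun t ht => ?_⟩
  by_contra hne
  have hgt : x t < y t := lt_of_le_of_ne (hyx t ht (hD0 t ht).ge) (Ne.symm hne)
  have hev := (hxl t ht).eventually_lt_const (u := (x t + y t) / 2) (by linarith)
  obtain ⟨l, hl, hl2⟩ := (mem_nhdsLT_iff_exists_Ioo_subset' (a := t) ht.1).1 hev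
  obtain ⟨l', hl'1, hl't⟩ := exists_between (max_lt ht.1 hl : max a l < t)
  have hal : a < l' := (le_max_left _ _).trans_lt hl'1
  have hll : l < l' := (le_max_right _ _).trans_lt hl'1
  have htm : t ∈ Icc a b := ⟨ht.1.le, ht.2⟩
  have hlm : l' ∈ Icc a b := ⟨hal.le, hl't.le.trans ht.2⟩
  have h1 := hDD l' hlm t htm
  rw [hDz _ hlm, hDz _ htm] at h1
  have h2 := intervalIntegral.integral_mono_on_of_le_Ioo (f := fun _ => (y t - x t) / 2)
        (g := fun z => y z - x z) (μ := volume) hl't.le (by simp)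
        (hint l' hlm t htm) (by
          intro z hz
          have e1 : x z < (x t + y t) / 2 := hl2 ⟨hll.trans hz.1, hz.2⟩
          have e2 := hy ⟨hal.le.trans hz.1.le, hz.2.le.trans ht.2⟩ htm hz.2.le
          linarith)
  simp only [intervalIntegral.integral_const, smul_eq_mul] at h2
  have : 0 < (t - l') * ((y t - x t) / 2) := mul_pos (by linarith) (by linarith)
  linarith

theorem stmt10 (θl θh qbar c α qhat : ℝ) (P qe r q u : ℝ → ℝ)
    (h0 : 0 < θl) (hlt : θl < θh) (hqbar : 0 < qbar) (hc : 0 < c)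
    (hα0 : 0 ≤ α) (hα1 : α < 1)
    (hPcont : ContinuousOn P (Icc 0 qbar))
    (hPanti : StrictAntiOn P (Icc 0 qbar))
    (hPqbar : P qbar = 0)
    (hqe : ∀ θ ∈ Icc θl θh, qe θ ∈ Icc 0 qbar ∧ P (qe θ) = θ)
    (hA2 : V P (qe θh) - c - θh * qe θh > 0)
    (hqhat_mem : qhat ∈ Ioo 0 qbar)
    (hqhat_eq : V P qhat - qhat * P qhat = c)
    (hvalid : Valid θl θh qbar r q)
    (hFR : FloorRandomized θl θh qhat r q u)
    (hLC : LeftCont θl θh r q)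
    (hsDD : q θl = qe θl ∧ ∀ θ ∈ Ioc θl θh, q θ < qe θ) :
    Undominated θl θh qbar P c α r q u := by
  obtain ⟨hIC, hIR, hu0, T1, T01, T0, hT, -, -, -, -, -, -, hT1, hT01, hT0⟩ := hFR
  refine ⟨hvalid, hIC, hIR, ?_⟩
  rintro ⟨r', q', u', hV', hIC', hIR', hdom, t0, ht0, hstrict⟩
  have htan := aux_tangent qbar P hPcont hPanti
  have hqm : qhat ∈ Icc 0 qbar := ⟨hqhat_mem.1.le, hqhat_mem.2.le⟩
  have hhm : θh ∈ Icc θl θh := right_mem_Icc.2 hlt.le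
  have hlm : θl ∈ Icc θl θh := left_mem_Icc.2 hlt.le
  have hGmono : ∀ a ∈ Icc 0 qbar, ∀ b ∈ Icc 0 qbar, a ≤ b →
      V P a - a * P a ≤ V P b - b * P b := by
    intro a ha b hb hab
    have h1 := htan a b ha hb
    have h2 := hPanti.antitoneOn ha hb hab
    nlinarith [ha.1]
  have hqh : qhat < qe θh := by
    by_contra! h
    have h1 := hGmono _ (hqe θh hhm).1 _ hqm h
    rw [(hqe θh hhm).2] at h1
    linarith
  have hqhe : ∀ θ ∈ Icc θl θh, qhat < qe θ := by
    intro θ hθ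
    refine hqh.trans_le ?_
    by_contra! h
    have := hPanti (hqe θ hθ).1 (hqe θh hhm).1 h
    rw [(hqe θ hθ).2, (hqe θh hhm).2] at this
    linarith [hθ.2]
  -- effective quantities
  have hxq : ∀ θ ∈ Icc θl θh, q θ * r θ ≤ q θ := fun θ hθ =>
    mul_le_of_le_one_right (hvalid.2 θ hθ).1 (hvalid.1 θ hθ).2
  have hsm : ∀ θ ∈ Icc θl θh, max (q θ * r θ) qhat ∈ Icc 0 qbar := fun θ hθ =>
    ⟨hqm.1.trans (le_max_right _ _), max_le ((hxq θ hθ).trans (hvalid.2 θ hθ).2) hqm.2⟩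
  set g : ℝ → ℝ := fun θ => P (max (q θ * r θ) qhat) - θ with hgdef
  have hkey : ∀ θ ∈ Icc θl θh, r' θ * (V P (q' θ) - c - θ * q' θ) -
      r θ * (V P (q θ) - c - θ * q θ) ≤ g θ * (q' θ * r' θ - q θ * r θ) := by
    intro θ hθ
    set s := max (q θ * r θ) qhat with hs
    have hsmθ := hsm θ hθ
    have e1 := htan (q' θ) s (hV'.2 θ hθ) hsmθ
    have e2 := hGmono qhat hqm s hsmθ (le_max_right _ _)
    obtain ⟨e3, e4⟩ := hV'.1 θ hθ
    have e5 : r θ * (V P (q θ) - c) = (V P s - s * P s - c) + P s * (q θ * r θ) := by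
      have hθ' := hθ
      rw [← hT] at hθ'
      rcases hθ' with (h | h) | h
      · obtain ⟨h1, h2⟩ := hT1 θ h
        have : s = q θ := by rw [hs, h2, mul_one, max_eq_left h1]
        rw [this, h2]; ring
      · obtain ⟨h1, h2⟩ := hT01 θ h
        have : s = qhat := by
          rw [hs, h1, max_eq_right (mul_le_of_le_one_right hqm.1 h2.2.le)]
        rw [this, h1]; linear_combination (r θ - 1) * hqhat_eq
      · obtain ⟨h1, h2⟩ := hT0 θ h
        have : s = qhat := by
          rw [hs, h1, zero_mul, max_eq_right hqm.1]
        rw [this, h1, h2]; linear_combination (-1) * hqhat_eq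
    have e6 : r' θ * (V P (q' θ) - c) ≤ r' θ * (V P s + P s * (q' θ - s) - c) := by gcongr
    have e7 : r' θ * (V P s - s * P s - c) ≤ V P s - s * P s - c :=
      mul_le_of_le_one_left (by linarith) e4
    have : g θ = P s - θ := rfl
    rw [this]
    linarith
  have hxl : q θl * r θl = qe θl := by
    have hθ' := hlm
    rw [← hT] at hθ'
    have := hqhe θl hlm
    rcases hθ' with (h | h) | h
    · rw [(hT1 _ h).2, mul_one, hsDD.1]
    · have := (hT01 _ h).1; linarith [hsDD.1]
    · have := (hT0 _ h).1; linarith [hsDD.1, hqm.1]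
  have hgl0 : g θl = 0 := by
    simp only [hgdef]
    rw [hxl, max_eq_left (hqhe θl hlm).le, (hqe θl hlm).2, sub_self]
  have hgpos : ∀ t ∈ Ioc θl θh, 0 < g t := by
    intro t ht
    have htm : t ∈ Icc θl θh := ⟨ht.1.le, ht.2⟩
    have h1 : max (q t * r t) qhat < qe t :=
      max_lt ((hxq t htm).trans_lt (hsDD.2 t ht)) (hqhe t htm)
    have := hPanti (hsm t htm) (hqe t htm).1 h1
    rw [(hqe t htm).2] at this
    simp only [hgdef]
    linarith
  have hgloc : ∀ t ∈ Ioc θl θh, ∃ δ > 0, ∃ l < t, ∀ z ∈ Ioc l t, δ ≤ g z := by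
    intro t ht
    have htm : t ∈ Icc θl θh := ⟨ht.1.le, ht.2⟩
    have h0 := hgpos t ht
    have hmax : Tendsto (fun z => max (q z * r z) qhat) (nhdsWithin t (Iio t))
        (nhds (max (q t * r t) qhat)) := (hLC t ht).max tendsto_const_nhds
    have hmem : ∀ᶠ z in nhdsWithin t (Iio t), max (q z * r z) qhat ∈ Icc 0 qbar := by
      filter_upwards [Ioo_mem_nhdsLT ht.1] with z hz
      exact hsm z ⟨hz.1.le, hz.2.le.trans ht.2⟩
    have h1 : Tendsto g (nhdsWithin t (Iio t)) (nhds (g t)) := by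
      apply Tendsto.sub
      · exact (hPcont _ (hsm t htm)).tendsto.comp (tendsto_nhdsWithin_iff.2 ⟨hmax, hmem⟩)
      · exact tendsto_id.mono_left nhdsWithin_le_nhds
    have hev := h1.eventually_const_lt (u := g t / 2) (by linarith)
    obtain ⟨l, hl, hl2⟩ := (mem_nhdsLT_iff_exists_Ioo_subset' (a := t) ht.1).1 hev
    refine ⟨g t / 2, by linarith, l, hl, fun z hz => ?_⟩
    rcases eq_or_lt_of_le hz.2 with h | h
    · rw [h]; linarith
    · exact le_of_lt (hl2 ⟨hz.1, h⟩)
  have hk : 0 < 1 - α := by linarith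
  have hDdom : ∀ t ∈ Icc θl θh, (1 - α) * (u' t - u t) ≤ g t * (q' t * r' t - q t * r t) := by
    intro t ht
    have h1 := hdom t ht
    have h2 := hkey t ht
    simp only [RS] at h1
    linarith
  obtain ⟨hD0, hxy⟩ := aux_abs θl θh (1 - α) (fun z => q z * r z) (fun z => q' z * r' z) g
    (fun z => u' z - u z) hlt hk hIC.1 hIC'.1 (by
      intro t ht
      have hsub : uIcc t θh ⊆ Icc θl θh := ordConnected_Icc.uIcc_subset ht hhm
      have i1 : IntervalIntegrable (fun z => q z * r z) volume t θh :=
        (hIC.1.mono hsub).intervalIntegrable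
      have i2 : IntervalIntegrable (fun z => q' z * r' z) volume t θh :=
        (hIC'.1.mono hsub).intervalIntegrable
      rw [intervalIntegral.integral_sub i2 i1, hIC.2 t ht, hIC'.2 t ht]
      ring) (by
      have : 0 ≤ u' θh := hIR'
      linarith) hgl0 hgpos hgloc hLC hDdom
  have h1 := hD0 t0 ht0
  have h2 := hkey t0 ht0
  have h3 : g t0 * (q' t0 * r' t0 - q t0 * r t0) = 0 := by
    rcases eq_or_lt_of_le ht0.1 with h | h
    · rw [← h, hgl0, zero_mul]
    · have := hxy t0 ⟨h, ht0.2⟩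
      rw [this, sub_self, mul_zero]
  simp only [RS] at hstrict
  have h4 : u' t0 = u t0 := by linarith
  rw [h4] at hstrict
  linarith
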